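/- Let G(z) = Σ_{n≥1} a_n z^n be a power series with integer coefficients satisfying 1 ≤ a₁ ≤ 4 and −8n ≤ a_n < 2^{n+2} for all n ≥ 2. Then G converges to a smooth function on [0, 1/2), G(0) = 0, and if additionally 1/(1−G(z)) is a power series with nonnegative coefficients whose radius of convergence R satisfies R ≤ 1/κ < 1/2, then G(R) = 1 and R is the smallest positive real solution of G(z) = 1. -/

import Mathlib

open Filter

/-- The two-index family arising from expanding `c n * (x + h) ^ n`. -/
noncomputable def prU (c : ℕ → ℝ) (x h : ℝ) (q : ℕ × ℕ) : ℝ :=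
  c q.1 * (h ^ q.2 * x ^ (q.1 - q.2) * (q.1.choose q.2 : ℝ))

lemma prU_nonneg (c : ℕ → ℝ) (hc : ∀ n, 0 ≤ c n) (x h : ℝ) (hx : 0 ≤ x) (hh : 0 ≤ h) :
    0 ≤ prU c x h := by
  intro q
  have := hc q.1
  simp only [prU, Pi.zero_apply]
  positivity

lemma prU_inner (c : ℕ → ℝ) (x h : ℝ) (n : ℕ) :
    HasSum (fun k => prU c x h (n, k)) (c n * (x + h) ^ n) := by
  rw [add_comm x h, add_pow, Finset.mul_sum]
  apply hasSum_sum_of_ne_finset_zero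
  intro k hk
  have : n < k := by simpa [Nat.lt_succ_iff] using hk
  simp [prU, Nat.choose_eq_zero_of_lt this]

lemma prU_summable_iff (c : ℕ → ℝ) (hc : ∀ n, 0 ≤ c n) (x h : ℝ) (hx : 0 ≤ x) (hh : 0 ≤ h) :
    Summable (prU c x h) ↔ Summable fun n => c n * (x + h) ^ n := by
  rw [summable_prod_of_nonneg (prU_nonneg c hc x h hx hh)]
  simp only [fun n => (prU_inner c x h n).tsum_eq]
  exact ⟨fun H => H.2, fun H => ⟨fun n => (prU_inner c x h n).summable, H⟩⟩

/-- A Pringsheim theorem: analytic continuation across `R` forces convergence beyond `R`. -/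
lemma pringsheim_real (c : ℕ → ℝ) (hc : ∀ n, 0 ≤ c n) (R : ℝ) (hR : 0 < R)
    (hs : ∀ x : ℝ, |x| < R → Summable fun n : ℕ => c n * x ^ n)
    (H : ℝ → ℝ) (hH : AnalyticAt ℝ H R)
    (heq : ∀ x, 0 < x → x < R → H x = ∑' n, c n * x ^ n) :
    ∃ x, R < x ∧ Summable fun n : ℕ => c n * x ^ n := by
  obtain ⟨p, r, hp⟩ := hH
  obtain ⟨s, hs0, hsr⟩ := ENNReal.lt_iff_exists_nnreal_btwn.1 hp.r_pos
  have hs0' : (0 : ℝ) < s := by exact_mod_cast hs0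
  obtain ⟨δ, hδ0, hδR, hδs⟩ : ∃ δ : ℝ, 0 < δ ∧ δ < R ∧ 3 * δ < s := by
    refine ⟨min (R / 2) (s / 4), by positivity, ?_, ?_⟩
    · exact (min_le_left _ _).trans_lt (by linarith)
    · have := min_le_right (R / 2) ((s : ℝ) / 4)
      linarith
  have hp2 := hp.mono (r' := s) (by exact_mod_cast hs0) hsr.le
  have hlt : (‖-δ‖₊ : ENNReal) < s := by
    norm_cast
    rw [← NNReal.coe_lt_coe]
    simp only [coe_nnnorm, norm_neg, Real.norm_eq_abs, abs_of_pos hδ0]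
    linarith
  have hq := hp2.changeOrigin hlt
  set q := p.changeOrigin (-δ)
  set x0 := R + -δ with hx0
  have hx0p : 0 < x0 := by linarith
  -- the expansion of the power series at `x0`
  set d : ℕ → ℝ := fun k => ∑' n, c n * (x0 ^ (n - k) * (n.choose k : ℝ)) with hd
  have hsumabs : ∀ h : ℝ, |h| < δ → Summable (prU c x0 h) := by
    intro h hh
    have h1 : Summable (prU c x0 |h|) := by
      rw [prU_summable_iff c hc x0 _ hx0p.le (abs_nonneg h)]
      apply hs
      rw [abs_of_pos (by positivity)]
      linarith
    refine h1.of_norm_bounded ?_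
    intro t
    simp only [prU, norm_mul, Real.norm_eq_abs, abs_pow, abs_of_nonneg (hc t.1), abs_of_pos hx0p,
      Nat.abs_cast, le_refl]
  have hcol : ∀ k, Summable fun n => c n * (x0 ^ (n - k) * (n.choose k : ℝ)) := by
    intro k
    have h1 := hsumabs (δ / 2) (by rw [abs_of_pos (by positivity)]; linarith)
    have h2 := (h1.prod_symm.prod_factor k).mul_left (((δ / 2) ^ k)⁻¹)
    refine h2.congr fun n => ?_
    simp only [prU, Prod.swap]
    field_simp
  have hcolsum : ∀ h k, HasSum (fun n => prU c x0 h (n, k)) (h ^ k * d k) := by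
    intro h k
    refine ((hcol k).hasSum.mul_left (h ^ k)).congr_fun ?_
    intro n
    simp only [prU]
    ring
  have hCser : HasFPowerSeriesAt (fun x => ∑' n, c n * x ^ n)
      (FormalMultilinearSeries.ofScalars ℝ d) x0 := by
    rw [hasFPowerSeriesAt_iff]
    filter_upwards [Metric.ball_mem_nhds (0 : ℝ) hδ0] with h hh
    have hh : |h| < δ := by simpa using hh
    have h1 := hsumabs h hh
    have h2 : HasSum (prU c x0 h) (∑' n, c n * (x0 + h) ^ n) := by
      rw [h1.hasSum.prod_fiberwise (fun n => prU_inner c x0 h n) |>.tsum_eq]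
      exact h1.hasSum
    have h3 : HasSum (prU c x0 h ∘ Prod.swap) (∑' n, c n * (x0 + h) ^ n) :=
      (Equiv.prodComm ℕ ℕ).hasSum_iff.2 h2
    have h4 := h3.prod_fiberwise (fun k => hcolsum h k)
    simpa using h4
  have heq' : q = FormalMultilinearSeries.ofScalars ℝ d := by
    refine hq.hasFPowerSeriesAt.eq_formalMultilinearSeries_of_eventually hCser ?_
    filter_upwards [Ioo_mem_nhds hx0p (show x0 < R by linarith)] with x hx
    exact heq x hx.1 hx.2
  have hmem : (2 * δ) ∈ Metric.eball (0 : ℝ) (s - ‖-δ‖₊) := by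
    rw [mem_eball_zero_iff, lt_tsub_iff_right]
    rw [← enorm_eq_nnnorm, Real.enorm_eq_ofReal_abs, Real.enorm_eq_ofReal_abs,
      ← ENNReal.ofReal_add (abs_nonneg _) (abs_nonneg _), abs_neg, abs_of_pos hδ0,
      abs_of_pos (by positivity), ENNReal.ofReal_lt_iff_lt_toReal (by positivity) (by simp)]
    simp only [ENNReal.coe_toReal]
    linarith
  have hfin := (hq.hasSum hmem).summable
  rw [heq'] at hfin
  refine ⟨x0 + 2 * δ, by linarith, ?_⟩
  rw [← prU_summable_iff c hc x0 _ hx0p.le (by positivity)]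
  rw [← (Equiv.prodComm ℕ ℕ).summable_iff, summable_prod_of_nonneg]
  · refine ⟨fun k => (hcolsum (2 * δ) k).summable, ?_⟩
    refine hfin.congr fun k => ?_
    rw [FormalMultilinearSeries.ofScalars_apply_eq, smul_eq_mul, mul_comm]
    exact ((hcolsum (2 * δ) k).tsum_eq).symm
  · exact fun t => prU_nonneg c hc x0 (2 * δ) hx0p.le (by positivity) (t.swap)

lemma coeff_abs_bound (a : ℕ → ℤ) (ha0 : a 0 = 0)
    (ha1 : 1 ≤ a 1 ∧ a 1 ≤ 4)
    (hbound : ∀ n : ℕ, 2 ≤ n → -(8 * (n : ℤ)) ≤ a n ∧ a n < 2 ^ (n + 2)) (n : ℕ) :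
    |(a n : ℝ)| ≤ 4 * 2 ^ n := by
  have key : |a n| ≤ 4 * 2 ^ n := by
    rcases n with _ | _ | n
    · simp [ha0]
    · rw [abs_le]
      constructor <;> norm_num <;> omega
    · obtain ⟨h1, h2⟩ := hbound (n + 2) (by omega)
      have h3 : (n : ℤ) + 1 ≤ 2 ^ n := by
        have := Nat.lt_two_pow_self (n := n)
        exact_mod_cast this
      have hp : (1 : ℤ) ≤ 2 ^ n := by
        have := Nat.one_le_two_pow (n := n)
        exact_mod_cast this
      rw [abs_le]
      push_cast at h1
      simp only [pow_add] at h2 ⊢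
      constructor <;> norm_num at h2 ⊢ <;> linarith
  exact_mod_cast key

lemma G_hasFPowerSeries (b : ℕ → ℝ) (hb : ∀ n, |b n| ≤ 4 * 2 ^ n) :
    HasFPowerSeriesOnBall (fun x : ℝ => ∑' n : ℕ, b n * x ^ n)
      (FormalMultilinearSeries.ofScalars ℝ b) 0 ((1 / 2 : NNReal) : ENNReal) := by
  have hr : ((1 / 2 : NNReal) : ENNReal) ≤ (FormalMultilinearSeries.ofScalars ℝ b).radius := by
    apply FormalMultilinearSeries.le_radius_of_bound _ 4
    intro n
    rw [FormalMultilinearSeries.ofScalars_norm, Real.norm_eq_abs]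
    calc |b n| * ((1 / 2 : NNReal) : ℝ) ^ n ≤ (4 * 2 ^ n) * (1 / 2 : ℝ) ^ n := by
          push_cast
          gcongr
          exact hb n
      _ = 4 := by rw [mul_assoc, ← mul_pow]; norm_num
  have hpos : (0 : ENNReal) < ((1 / 2 : NNReal) : ENNReal) := by
    norm_cast
    positivity
  have h := ((FormalMultilinearSeries.ofScalars ℝ b).hasFPowerSeriesOnBall
    (hpos.trans_le hr)).mono hpos hr
  have e : (FormalMultilinearSeries.ofScalars ℝ b).sum = fun x : ℝ => ∑' n : ℕ, b n * x ^ n := by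
    have := FormalMultilinearSeries.ofScalarsSum_eq_tsum (E := ℝ) b
    simpa [FormalMultilinearSeries.ofScalarsSum] using this
  rwa [e] at h

lemma mem_half_ball (x : ℝ) (hx : |x| < 1 / 2) :
    x ∈ Metric.eball (0 : ℝ) ((1 / 2 : NNReal) : ENNReal) := by
  rw [Metric.eball_coe]
  simpa using hx

lemma G_summable_norm (b : ℕ → ℝ) (hb : ∀ n, |b n| ≤ 4 * 2 ^ n) (x : ℝ) (hx : |x| < 1 / 2) :
    Summable fun n => ‖b n * x ^ n‖ := by
  have h := G_hasFPowerSeries b hb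
  have := (FormalMultilinearSeries.ofScalars ℝ b).summable_norm_apply
    (Metric.eball_subset_eball h.r_le (mem_half_ball x hx))
  simpa [FormalMultilinearSeries.ofScalars_apply_eq, mul_comm] using this

lemma c_bound (b c : ℕ → ℝ) (hb0 : b 0 = 0) (hb : ∀ n, |b n| ≤ 4 * 2 ^ n)
    (h0 : c 0 = 1)
    (hrec : ∀ n, c (n + 1) = ∑ k ∈ Finset.range (n + 1), c (n - k) * b (k + 1)) (n : ℕ) :
    |c n| ≤ 10 ^ n := by
  induction n using Nat.strong_induction_on with
  | _ n ih =>
    rcases n with _ | n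
    · simp [h0]
    · rw [hrec]
      calc |∑ k ∈ Finset.range (n + 1), c (n - k) * b (k + 1)|
          ≤ ∑ k ∈ Finset.range (n + 1), |c (n - k) * b (k + 1)| := Finset.abs_sum_le_sum_abs _ _
        _ ≤ ∑ k ∈ Finset.range (n + 1), (8 * 10 ^ n) * (1 / 5 : ℝ) ^ k := by
            apply Finset.sum_le_sum
            intro k hk
            have hk' : k ≤ n := by simpa [Nat.lt_succ_iff] using hk
            rw [abs_mul]
            calc |c (n - k)| * |b (k + 1)| ≤ 10 ^ (n - k) * (4 * 2 ^ (k + 1)) := by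
                  gcongr
                  · exact ih _ (by omega)
                  · exact hb _
              _ = (8 * 10 ^ n) * (1 / 5 : ℝ) ^ k := by
                  obtain ⟨m, rfl⟩ := Nat.exists_eq_add_of_le hk'
                  rw [Nat.add_sub_cancel_left, pow_add (10 : ℝ) k m, one_div, inv_pow,
                    show (10 : ℝ) = 2 * 5 by norm_num, mul_pow 2 5 k]
                  field_simp
                  ring
        _ ≤ 10 ^ (n + 1) := by
            rw [← Finset.mul_sum, geom_sum_eq (by norm_num)]
            have : (0 : ℝ) < (1 / 5) ^ (n + 1) := by positivity
            have h10 : (0 : ℝ) < 10 ^ n := by positivity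
            have e : ((1 / 5 : ℝ) ^ (n + 1) - 1) / (1 / 5 - 1) ≤ 5 / 4 := by
              rw [div_le_iff_of_neg (by norm_num)]
              linarith
            calc 8 * 10 ^ n * (((1 / 5 : ℝ) ^ (n + 1) - 1) / (1 / 5 - 1))
                ≤ 8 * 10 ^ n * (5 / 4) := by gcongr
              _ = 10 ^ (n + 1) := by ring

lemma ps_product (b c : ℕ → ℝ) (x : ℝ)
    (hmul : (PowerSeries.mk c) * (1 - PowerSeries.mk b) = 1)
    (hb : Summable fun n => ‖b n * x ^ n‖) (hc : Summable fun n => ‖c n * x ^ n‖) :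
    (∑' n, c n * x ^ n) * (1 - ∑' n, b n * x ^ n) = 1 := by
  rw [mul_sub, mul_one, tsum_mul_tsum_eq_tsum_sum_antidiagonal_of_summable_norm hc hb,
    ← Summable.tsum_sub hc.of_norm
      (summable_norm_sum_mul_antidiagonal_of_summable_norm hc hb).of_norm]
  rw [tsum_eq_single 0]
  · have h := congrArg (PowerSeries.coeff 0) hmul
    rw [mul_sub, mul_one] at h
    simp [PowerSeries.coeff_mul] at h ⊢
    linarith
  · intro n hn
    have h := congrArg (PowerSeries.coeff n) hmul
    rw [mul_sub, mul_one] at h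
    simp only [map_sub, PowerSeries.coeff_mul, PowerSeries.coeff_mk, PowerSeries.coeff_one,
      if_neg hn] at h
    have : ∑ kl ∈ Finset.HasAntidiagonal.antidiagonal n, c kl.1 * x ^ kl.1 * (b kl.2 * x ^ kl.2)
        = (∑ kl ∈ Finset.HasAntidiagonal.antidiagonal n, c kl.1 * b kl.2) * x ^ n := by
      rw [Finset.sum_mul]
      refine Finset.sum_congr rfl fun kl hkl => ?_
      rw [← Finset.HasAntidiagonal.mem_antidiagonal.1 hkl, pow_add]
      ring
    rw [this, ← sub_mul, h, zero_mul]

lemma ps_rec (b c : ℕ → ℝ) (hb0 : b 0 = 0)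
    (hmul : (PowerSeries.mk c) * (1 - PowerSeries.mk b) = 1) :
    c 0 = 1 ∧ ∀ n, c (n + 1) = ∑ k ∈ Finset.range (n + 1), c (n - k) * b (k + 1) := by
  rw [mul_sub, mul_one] at hmul
  constructor
  · have h := congrArg (PowerSeries.coeff 0) hmul
    simpa [PowerSeries.coeff_mul, hb0] using h
  · intro n
    have h := congrArg (PowerSeries.coeff (n + 1)) hmul
    simp only [map_sub, PowerSeries.coeff_mul, PowerSeries.coeff_mk, PowerSeries.coeff_one,
      if_neg (Nat.succ_ne_zero n)] at h
    rw [← Finset.Nat.sum_antidiagonal_swap, Finset.Nat.sum_antidiagonal_eq_sum_range_succ_mk,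
      Finset.sum_range_succ'] at h
    simp [hb0] at h
    linarith

/-- Properties of the amended `G`-sequence: with integer
coefficients `a` satisfying `a 0 = 0`, `1 ≤ a 1 ≤ 4` and `−8n ≤ a n < 2^(n+2)`
for `n ≥ 2`, the series `G(z) = Σ aₙ zⁿ` converges to a smooth function on
`[0, 1/2)` with `G(0) = 0`; and if `1/(1−G)` is a power series with
nonnegative coefficients whose radius of convergence `R` satisfies
`R ≤ 1/κ < 1/2` (κ the reciprocal of the smallest positive root of
`1 − 2z − z³`), then `G(R) = 1` and `R` is the smallest positive real solution
of `G(z) = 1`. -/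
theorem G_sequence_properties (a : ℕ → ℤ) (ha0 : a 0 = 0)
    (ha1 : 1 ≤ a 1 ∧ a 1 ≤ 4)
    (hbound : ∀ n : ℕ, 2 ≤ n → -(8 * (n : ℤ)) ≤ a n ∧ a n < 2 ^ (n + 2)) :
    (∀ x : ℝ, x ∈ Set.Ico (0 : ℝ) (1 / 2) →
      Summable fun n : ℕ => (a n : ℝ) * x ^ n) ∧
    ContDiffOn ℝ (⊤ : ℕ∞) (fun x : ℝ => ∑' n : ℕ, (a n : ℝ) * x ^ n)
      (Set.Ico (0 : ℝ) (1 / 2)) ∧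
    (∑' n : ℕ, (a n : ℝ) * (0 : ℝ) ^ n) = 0 ∧
    ∀ (κ : ℝ) (c : ℕ → ℝ) (R : ℝ),
      0 < κ⁻¹ → 1 - 2 * κ⁻¹ - κ⁻¹ ^ 3 = 0 →
      (∀ y : ℝ, 0 < y → 1 - 2 * y - y ^ 3 = 0 → κ⁻¹ ≤ y) →
      (∀ n, 0 ≤ c n) →
      (PowerSeries.mk c) * (1 - PowerSeries.mk fun n => (a n : ℝ)) = 1 →
      (∀ x : ℝ, |x| < R → Summable fun n : ℕ => c n * x ^ n) →
      (∀ x : ℝ, R < |x| → ¬ Summable fun n : ℕ => c n * x ^ n) →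
      R ≤ κ⁻¹ → κ⁻¹ < 1 / 2 →
      (0 < R ∧ (∑' n : ℕ, (a n : ℝ) * R ^ n) = 1 ∧
        ∀ x : ℝ, 0 < x → (∑' n : ℕ, (a n : ℝ) * x ^ n) = 1 → R ≤ x) := by
  have hab := coeff_abs_bound a ha0 ha1 hbound
  have hG := G_hasFPowerSeries (fun n => (a n : ℝ)) hab
  have hGan : ∀ x : ℝ, |x| < 1 / 2 → AnalyticAt ℝ (fun x : ℝ => ∑' n : ℕ, (a n : ℝ) * x ^ n) x :=
    fun x hx => hG.analyticAt_of_mem (mem_half_ball x hx)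
  have hsn : ∀ x : ℝ, |x| < 1 / 2 → Summable fun n : ℕ => ‖(a n : ℝ) * x ^ n‖ :=
    fun x hx => G_summable_norm (fun n => (a n : ℝ)) hab x hx
  refine ⟨fun x hx => (hsn x ?_).of_norm, ?_, ?_, ?_⟩
  · rw [abs_of_nonneg hx.1]
    exact hx.2
  · intro x hx
    refine (hGan x ?_).contDiffAt.contDiffWithinAt
    rw [abs_of_nonneg hx.1]
    exact hx.2
  · rw [tsum_eq_single 0]
    · simp [ha0]
    · intro n hn
      simp [hn]
  intro κ c R _ _ _ hc hmul hconv hdiv hRκ hκ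
  have hR2 : R < 1 / 2 := hRκ.trans_lt hκ
  obtain ⟨hc0, hrec⟩ := ps_rec _ c (by simp [ha0]) hmul
  have hcb := c_bound (fun n => (a n : ℝ)) c (by simp [ha0]) hab hc0 hrec
  have hR : 0 < R := by
    by_contra hneg
    refine hdiv (1 / 20) (lt_of_le_of_lt (not_lt.1 hneg) (by norm_num)) ?_
    refine (summable_geometric_two).of_norm_bounded ?_
    intro n
    rw [norm_mul, Real.norm_eq_abs, norm_pow, show ‖(1 / 20 : ℝ)‖ = 1 / 20 by norm_num]
    calc |c n| * (1 / 20 : ℝ) ^ n ≤ 10 ^ n * (1 / 20 : ℝ) ^ n := by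
          gcongr
          exact hcb n
      _ = (1 / 2) ^ n := by rw [← mul_pow]; norm_num
  have hprod : ∀ x : ℝ, 0 ≤ x → x < R →
      (∑' n, c n * x ^ n) * (1 - ∑' n, (a n : ℝ) * x ^ n) = 1 := by
    intro x hx0 hxR
    refine ps_product _ c x hmul (hsn x ?_) ?_
    · rw [abs_of_nonneg hx0]
      linarith
    · exact (hconv x (by rwa [abs_of_nonneg hx0])).norm
  refine ⟨hR, ?_, ?_⟩
  · by_contra hne
    have hH : AnalyticAt ℝ (fun x : ℝ => (1 - ∑' n : ℕ, (a n : ℝ) * x ^ n)⁻¹) R := by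
      refine AnalyticAt.inv (analyticAt_const.sub (hGan R ?_)) ?_
      · rwa [abs_of_pos hR]
      · exact sub_ne_zero.2 (Ne.symm hne)
    obtain ⟨x, hx, hxs⟩ := pringsheim_real c hc R hR hconv _ hH
      (fun x hx0 hxR => (eq_inv_of_mul_eq_one_left (hprod x hx0.le hxR)).symm)
    exact hdiv x (by rwa [abs_of_pos (hR.trans hx)]) hxs
  · intro x hx hx1
    by_contra hlt
    have := hprod x hx.le (not_le.1 hlt)
    rw [hx1] at this
    simp at this
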